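/- (Localized log-Sobolev inequality) Let A ⊆ ℝ be an interval and W ∈ C²(A) with W″ ≥ α > 0 on A and ∫_A e^{−W} dx < ∞. Let ν(dx) = e^{−W(x)}·1_A(x) dx. Then for every nonnegative finite Borel measure μ on A with μ = f·ν: α·(∫_A f log f dν − μ(A)·log(μ(A)/ν(A))) ≤ 2·∫_A |d/dx √f|² dν. -/

import Mathlib

open MeasureTheory Real

/-- A uniformly convex function lies above its tangent parabolas. -/
lemma tangent_parabola_le {A : Set ℝ} (hA : Convex ℝ A) {W W' W'' : ℝ → ℝ} {α : ℝ}
    (hW : ∀ x ∈ A, HasDerivAt W (W' x) x) (hW' : ∀ x ∈ A, HasDerivAt W' (W'' x) x)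
    (hconv : ∀ x ∈ A, α ≤ W'' x) {x y : ℝ} (hx : x ∈ A) (hy : y ∈ A) :
    W x + W' x * (y - x) + α / 2 * (y - x) ^ 2 ≤ W y := by
  have hV : ∀ z ∈ A, HasDerivAt (fun z => W z - α / 2 * (z - x) ^ 2) (W' z - α * (z - x)) z := by
    intro z hz
    have h := (hW z hz).fun_sub ((((hasDerivAt_id' z).sub_const x).fun_pow 2).const_mul (α / 2))
    refine h.congr_deriv ?_
    norm_num
    ring
  have hV' : ∀ z ∈ A, HasDerivAt (fun z => W' z - α * (z - x)) (W'' z - α) z := by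
    intro z hz
    simpa using (hW' z hz).fun_sub (((hasDerivAt_id' z).sub_const x).const_mul α)
  have hVconv : ConvexOn ℝ A (fun z => W z - α / 2 * (z - x) ^ 2) :=
    convexOn_of_hasDerivWithinAt2_nonneg hA
      (fun z hz => (hV z hz).continuousAt.continuousWithinAt)
      (fun z hz => (hV z (interior_subset hz)).hasDerivWithinAt)
      (fun z hz => (hV' z (interior_subset hz)).hasDerivWithinAt)
      (fun z hz => sub_nonneg.2 (hconv z (interior_subset hz)))
  rcases lt_trichotomy x y with h | rfl | h
  · have hs := hVconv.le_slope_of_hasDerivAt hx hy h (hV x hx)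
    rw [slope_def_field, le_div_iff₀ (sub_pos.2 h)] at hs
    simp only [sub_self] at hs
    linarith
  · simp
  · have hs := hVconv.slope_le_of_hasDerivAt hy hx h (hV x hx)
    rw [slope_def_field, div_le_iff₀ (sub_pos.2 h)] at hs
    simp only [sub_self] at hs
    linarith

/-- A primitive of a function bounded below by a positive constant has a differentiable inverse. -/
lemma exists_inverse_of_hasDerivAt {F p : ℝ → ℝ} {c : ℝ} (hc : 0 < c) (hp : ∀ x, c ≤ p x)
    (hF : ∀ x, HasDerivAt F (p x) x) :
    ∃ G : ℝ → ℝ, Monotone G ∧ (∀ x, G (F x) = x) ∧ (∀ y, F (G y) = y) ∧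
      ∀ y, HasDerivAt G (p (G y))⁻¹ y := by
  have hmono : StrictMono F := strictMono_of_deriv_pos fun x => by
    rw [(hF x).deriv]; exact hc.trans_le (hp x)
  have hsub : ∀ x, HasDerivAt (fun x => F x - c * x) (p x - c) x := fun x => by
    simpa using (hF x).fun_sub ((hasDerivAt_id' x).const_mul c)
  have hlin : Monotone fun x => F x - c * x :=
    monotone_of_deriv_nonneg (fun x => (hsub x).differentiableAt) fun x => by
      rw [(hsub x).deriv]; exact sub_nonneg.2 (hp x)
  have htop : Filter.Tendsto F Filter.atTop Filter.atTop := by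
    refine Filter.tendsto_atTop_mono' _ ?_ (Filter.tendsto_atTop_add_const_right _ (F 0)
      (Filter.tendsto_id.const_mul_atTop hc))
    filter_upwards [Filter.eventually_ge_atTop 0] with x hx
    have := hlin hx
    simp only [id, mul_zero, sub_zero] at this ⊢
    linarith
  have hbot : Filter.Tendsto F Filter.atBot Filter.atBot := by
    refine Filter.tendsto_atBot_mono' _ ?_ (Filter.tendsto_atBot_add_const_right _ (F 0)
      (Filter.tendsto_id.const_mul_atBot hc))
    filter_upwards [Filter.eventually_le_atBot 0] with x hx
    have := hlin hx
    simp only [id, mul_zero, sub_zero] at this ⊢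
    linarith
  have hcont : Continuous F := continuous_iff_continuousAt.2 fun x => (hF x).continuousAt
  let e := hmono.orderIsoOfSurjective F (hcont.surjective htop hbot)
  have hright : ∀ y, F (e.symm y) = y := e.apply_symm_apply
  exact ⟨e.symm, e.symm.monotone, e.symm_apply_apply, hright, fun y =>
    HasDerivAt.of_local_left_inverse e.symm.continuous.continuousAt (hF _)
      (hc.trans_le (hp _)).ne' (Filter.Eventually.of_forall hright)⟩

/-- Monotone transport on `[a, b]` of the density `q` onto the positive density `p`. -/
lemma exists_monotone_transport {a b : ℝ} (hab : a ≤ b) {p q : ℝ → ℝ}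
    (hp : ContinuousOn p (Set.Icc a b)) (hp0 : ∀ x ∈ Set.Icc a b, 0 < p x)
    (hq : ContinuousOn q (Set.Icc a b)) (hq0 : ∀ x ∈ Set.Icc a b, 0 ≤ q x)
    (hM : 0 < ∫ x in a..b, q x) :
    ∃ T : ℝ → ℝ, T a = a ∧ T b = b ∧
      (∀ x ∈ Set.Icc a b, T x ∈ Set.Icc a b) ∧
      ∀ x ∈ Set.Icc a b,
        HasDerivAt T ((∫ x in a..b, p x) / (∫ x in a..b, q x) * q x / p (T x)) x := by
  set N := ∫ x in a..b, p x
  set M := ∫ x in a..b, q x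
  let k : ℝ → ℝ := fun x => max a (min b x)
  have hk : Continuous k := continuous_const.max (continuous_const.min continuous_id)
  have hkmem : ∀ x, k x ∈ Set.Icc a b := fun x =>
    ⟨le_max_left _ _, max_le hab (min_le_left _ _)⟩
  have hkid : ∀ x ∈ Set.Icc a b, k x = x := fun x hx => by
    simp [k, min_eq_right hx.2, max_eq_right hx.1]
  have hpk : Continuous fun x => p (k x) := hp.comp_continuous hk hkmem
  have hqk : Continuous fun x => q (k x) := hq.comp_continuous hk hkmem
  obtain ⟨m, hm, hmin⟩ := isCompact_Icc.exists_isMinOn (Set.nonempty_Icc.2 hab) hp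
  let F : ℝ → ℝ := fun y => ∫ x in a..y, p (k x)
  let H : ℝ → ℝ := fun y => ∫ x in a..y, q (k x)
  have hF : ∀ x, HasDerivAt F (p (k x)) x := fun x =>
    (hpk.integral_hasStrictDerivAt a x).hasDerivAt
  have hH : ∀ x, HasDerivAt H (q (k x)) x := fun x =>
    (hqk.integral_hasStrictDerivAt a x).hasDerivAt
  have hFb : F b = N := intervalIntegral.integral_congr fun x hx => by
    rw [Set.uIcc_of_le hab] at hx; simp only [hkid x hx]
  have hHb : H b = M := intervalIntegral.integral_congr fun x hx => by
    rw [Set.uIcc_of_le hab] at hx; simp only [hkid x hx]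
  have hN0 : 0 ≤ N := intervalIntegral.integral_nonneg hab fun x hx => (hp0 x hx).le
  obtain ⟨G, hG, hGF, -, hG'⟩ := exists_inverse_of_hasDerivAt (hp0 m hm)
    (fun x => hmin (hkmem x)) hF
  have hHmono : Monotone H := monotone_of_deriv_nonneg (fun x => (hH x).differentiableAt)
    fun x => by rw [(hH x).deriv]; exact hq0 _ (hkmem x)
  have hTmono : Monotone fun x => G (N / M * H x) := fun x y hxy =>
    hG (mul_le_mul_of_nonneg_left (hHmono hxy) (div_nonneg hN0 hM.le))
  have hTa : G (N / M * H a) = a := by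
    have : N / M * H a = F a := by simp [H, F]
    rw [this, hGF]
  have hTb : G (N / M * H b) = b := by
    rw [hHb, div_mul_cancel₀ _ hM.ne', ← hFb, hGF]
  have hT' : ∀ x, HasDerivAt (fun x => G (N / M * H x))
      ((p (k (G (N / M * H x))))⁻¹ * (N / M * q (k x))) x := fun x =>
    (hG' _).comp x ((hH x).const_mul (N / M))
  have hTmem : ∀ x ∈ Set.Icc a b, G (N / M * H x) ∈ Set.Icc a b := fun x hx =>
    ⟨hTa.symm.le.trans (hTmono hx.1), (hTmono hx.2).trans hTb.le⟩
  refine ⟨fun x => G (N / M * H x), hTa, hTb, hTmem, fun x hx => ?_⟩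
  convert hT' x using 1
  rw [hkid x hx, hkid _ (hTmem x hx)]
  ring

/-- Log-Sobolev inequality on a compact interval, by integrating along the monotone transport. -/
lemma log_sobolev_Icc {a b : ℝ} (hab : a ≤ b) {W W' W'' : ℝ → ℝ} {α : ℝ} (hα : 0 < α)
    (hW : ∀ x ∈ Set.Icc a b, HasDerivAt W (W' x) x)
    (hW' : ∀ x ∈ Set.Icc a b, HasDerivAt W' (W'' x) x)
    (hconv : ∀ x ∈ Set.Icc a b, α ≤ W'' x)
    {g g' : ℝ → ℝ} (hg : ∀ x ∈ Set.Icc a b, HasDerivAt g (g' x) x)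
    (hfisher : IntegrableOn (fun x => exp (-W x) * g' x ^ 2) (Set.Icc a b))
    (hM : 0 < ∫ x in a..b, exp (-W x) * g x ^ 2) :
    α * ((∫ x in a..b, exp (-W x) * (g x ^ 2 * log (g x ^ 2)))
        - (∫ x in a..b, exp (-W x) * g x ^ 2) *
          log ((∫ x in a..b, exp (-W x) * g x ^ 2) / ∫ x in a..b, exp (-W x)))
      ≤ 2 * ∫ x in a..b, exp (-W x) * g' x ^ 2 := by
  have hWc : ContinuousOn W (Set.Icc a b) := fun x hx =>
    (hW x hx).continuousAt.continuousWithinAt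
  have hgc : ContinuousOn g (Set.Icc a b) := fun x hx =>
    (hg x hx).continuousAt.continuousWithinAt
  have hpc : ContinuousOn (fun x => exp (-W x)) (Set.Icc a b) := hWc.neg.rexp
  have hqc : ContinuousOn (fun x => exp (-W x) * g x ^ 2) (Set.Icc a b) := hpc.mul (hgc.pow 2)
  have hec : ContinuousOn (fun x => exp (-W x) * (g x ^ 2 * log (g x ^ 2))) (Set.Icc a b) :=
    hpc.mul (continuous_mul_log.comp_continuousOn (hgc.pow 2))
  obtain ⟨T, hTa, hTb, hTmem, hT'⟩ := exists_monotone_transport hab hpc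
    (fun x _ => exp_pos _) hqc (fun x _ => by positivity) hM
  have hlt : a < b := by
    rcases hab.eq_or_lt with rfl | h
    · simp at hM
    · exact h
  have hN : 0 < ∫ x in a..b, exp (-W x) :=
    intervalIntegral.intervalIntegral_pos_of_pos_on (hpc.intervalIntegrable_of_Icc hab)
      (fun x _ => exp_pos _) hlt
  set M := ∫ x in a..b, exp (-W x) * g x ^ 2
  set N := ∫ x in a..b, exp (-W x)
  have hB : ∀ x ∈ Set.Icc a b, HasDerivAt (fun x => (T x - x) * (exp (-W x) * g x ^ 2))
      ((N / M * (exp (-W x) * g x ^ 2) / exp (-W (T x)) - 1) * (exp (-W x) * g x ^ 2)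
        + (T x - x) * (exp (-W x) * -W' x * g x ^ 2 + exp (-W x) * (2 * g x * g' x))) x := by
    intro x hx
    have h := ((hT' x hx).fun_sub (hasDerivAt_id' x)).fun_mul
      ((hW x hx).fun_neg.exp.fun_mul ((hg x hx).fun_pow 2))
    simpa using h
  have hi1 := (hec.integrableOn_Icc (μ := volume)).sub
    ((hqc.integrableOn_Icc (μ := volume)).mul_const (log (M / N)))
  have hi2 := hfisher.const_mul (2 / α)
  have key := intervalIntegral.integral_le_sub_of_hasDeriv_right_of_le hab
    (φ := fun x => (exp (-W x) * (g x ^ 2 * log (g x ^ 2)) - exp (-W x) * g x ^ 2 * log (M / N))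
      - 2 / α * (exp (-W x) * g' x ^ 2))
    (fun x hx => (hB x hx).continuousAt.continuousWithinAt)
    (fun x hx => (hB x (Set.Ioo_subset_Icc_self hx)).hasDerivWithinAt)
    (hi1.sub hi2) ?_
  · have e1 := hec.intervalIntegrable_of_Icc (μ := volume) hab
    have e2 := (hqc.intervalIntegrable_of_Icc (μ := volume) hab).mul_const (log (M / N))
    have e3 : IntervalIntegrable (fun x => exp (-W x) * g' x ^ 2) volume a b :=
      (intervalIntegrable_iff_integrableOn_Icc_of_le hab).2 hfisher
    rw [intervalIntegral.integral_sub (e1.sub e2) (e3.const_mul _),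
      intervalIntegral.integral_sub e1 e2, intervalIntegral.integral_mul_const,
      intervalIntegral.integral_const_mul, hTa, hTb] at key
    have h2 := mul_le_mul_of_nonneg_left key hα.le
    simp only [sub_self, zero_mul, mul_zero] at h2
    rw [mul_sub, ← mul_assoc, mul_div_cancel₀ _ hα.ne'] at h2
    exact sub_nonpos.1 h2
  · intro x hx'
    have hx := Set.Ioo_subset_Icc_self hx'
    have hE := exp_pos (-W x)
    rcases eq_or_ne (g x) 0 with h0 | h0
    · have : 0 ≤ 2 / α * (exp (-W x) * g' x ^ 2) := by positivity
      simpa [h0] using this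
    · have hpar := tangent_parabola_le (convex_Icc a b) hW hW' hconv hx (hTmem x hx)
      have hg2 : 0 < g x ^ 2 := by positivity
      set D := N / M * (exp (-W x) * g x ^ 2) / exp (-W (T x)) with hD
      have hD0 : 0 < D := by positivity
      have hlog : log D = log (g x ^ 2) - log (M / N) - W x + W (T x) := by
        rw [hD, log_div (by positivity) (exp_pos _).ne', log_mul (by positivity) (by positivity),
          log_mul hE.ne' hg2.ne', log_exp, log_exp, log_div hN.ne' hM.ne',
          log_div hM.ne' hN.ne']
        ring
      have hle := log_le_sub_one_of_pos hD0
      have hamgm : -(2 / α * g' x ^ 2) ≤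
          (T x - x) * (2 * g x * g' x) + α / 2 * (T x - x) ^ 2 * g x ^ 2 := by
        have : (T x - x) * (2 * g x * g' x) + α / 2 * (T x - x) ^ 2 * g x ^ 2
            + 2 / α * g' x ^ 2 = α / 2 * ((T x - x) * g x + 2 / α * g' x) ^ 2 := by
          field_simp
          ring
        have : 0 ≤ α / 2 * ((T x - x) * g x + 2 / α * g' x) ^ 2 := by positivity
        linarith
      have hmain : log (g x ^ 2) - log (M / N) ≤
          (D - 1) - W' x * (T x - x) - α / 2 * (T x - x) ^ 2 := by linarith
      have h1 := mul_le_mul_of_nonneg_left hmain hg2.le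
      have h2 : g x ^ 2 * log (g x ^ 2) - g x ^ 2 * log (M / N) - 2 / α * g' x ^ 2 ≤
          (D - 1) * g x ^ 2 + (T x - x) * (-W' x * g x ^ 2 + 2 * g x * g' x) := by
        linarith
      have h3 := mul_le_mul_of_nonneg_left h2 hE.le
      linarith

/-- Localized log-Sobolev inequality for a uniformly convex potential `W` on an
interval `A ⊆ ℝ`.  The reference measure is `ν = e^{−W} 1_A dx`, `μ = f·ν`,
and `sq'` is the (classical) derivative of `√f` on `A`. -/
theorem localized_log_sobolev
    (A : Set ℝ) (hA : Convex ℝ A) (hAmeas : MeasurableSet A)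
    (W W' W'' : ℝ → ℝ) (α : ℝ) (hα : 0 < α)
    (hW : ∀ x ∈ A, HasDerivAt W (W' x) x)
    (hW' : ∀ x ∈ A, HasDerivAt W' (W'' x) x)
    (hconv : ∀ x ∈ A, α ≤ W'' x)
    (ν μ : Measure ℝ)
    (hν : ν = (volume.restrict A).withDensity (fun x => ENNReal.ofReal (Real.exp (-W x))))
    (hνfin : IsFiniteMeasure ν)
    (f : ℝ → ℝ) (hf : Measurable f) (hf0 : ∀ x, 0 ≤ f x)
    (hμ : μ = ν.withDensity (fun x => ENNReal.ofReal (f x)))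
    (hμfin : IsFiniteMeasure μ)
    (sq' : ℝ → ℝ)
    (hsq : ∀ x ∈ A, HasDerivAt (fun y => Real.sqrt (f y)) (sq' x) x)
    (hent : IntegrableOn (fun x => f x * Real.log (f x)) A ν)
    (hfisher : IntegrableOn (fun x => sq' x ^ 2) A ν) :
    α * ((∫ x in A, f x * Real.log (f x) ∂ν)
          - (μ A).toReal * Real.log ((μ A).toReal / (ν A).toReal))
      ≤ 2 * ∫ x in A, sq' x ^ 2 ∂ν := by
  have hνA : ν.restrict A = ν := by
    rw [hν, restrict_withDensity hAmeas, Measure.restrict_restrict hAmeas, Set.inter_self]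
  have hfint : Integrable f ν := by
    refine ⟨hf.aestronglyMeasurable, ?_⟩
    rw [hasFiniteIntegral_iff_ofReal (Filter.Eventually.of_forall hf0)]
    have := measure_lt_top μ Set.univ
    rwa [hμ, withDensity_apply _ MeasurableSet.univ, Measure.restrict_univ] at this
  have hμA : (μ A).toReal = ∫ x, f x ∂ν := by
    rw [hμ, withDensity_apply _ hAmeas, hνA,
      integral_eq_lintegral_of_nonneg_ae (Filter.Eventually.of_forall hf0)
        hf.aestronglyMeasurable]
  have hνA' : (ν A).toReal = ∫ _, (1 : ℝ) ∂ν := by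
    rw [integral_const, smul_eq_mul, mul_one, ← Measure.restrict_apply_univ, hνA]
    rfl
  rw [IntegrableOn, hνA] at hent hfisher
  rw [hμA, hνA', hνA]
  rcases (integral_nonneg hf0 : 0 ≤ ∫ x, f x ∂ν).eq_or_lt with hM | hM
  · have h0 : f =ᵐ[ν] 0 := (integral_eq_zero_iff_of_nonneg hf0 hfint).1 hM.symm
    have : ∫ x, f x * log (f x) ∂ν = 0 :=
      integral_eq_zero_of_ae (h0.mono fun x hx => by simp [hx])
    rw [this, ← hM]
    simp only [zero_mul, sub_self, mul_zero]
    have : 0 ≤ ∫ x, sq' x ^ 2 ∂ν := integral_nonneg fun x => sq_nonneg _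
    positivity
  have hne : A.Nonempty := by
    rw [Set.nonempty_iff_ne_empty]
    rintro rfl
    simp [hν] at hM
  have : Nonempty A := hne.to_subtype
  have : A.OrdConnected := hA.ordConnected
  obtain ⟨u, -, hu⟩ := Filter.exists_seq_antitone_tendsto_atTop_atBot A
  obtain ⟨v, -, hv⟩ := Filter.exists_seq_monotone_tendsto_atTop_atTop A
  have hcover : AECover ν Filter.atTop fun n => Set.Icc (u n : ℝ) (v n) := by
    refine ⟨?_, fun n => measurableSet_Icc⟩
    rw [← hνA]
    filter_upwards [ae_restrict_mem hAmeas] with x hx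
    filter_upwards [hu.eventually_le_atBot ⟨x, hx⟩, hv.eventually_ge_atTop ⟨x, hx⟩] with n h1 h2
    exact ⟨h1, h2⟩
  have hM' := hcover.integral_tendsto_of_countably_generated hfint
  have hN' := hcover.integral_tendsto_of_countably_generated (integrable_const (1 : ℝ))
  have hE' := hcover.integral_tendsto_of_countably_generated hent
  have hI' := hcover.integral_tendsto_of_countably_generated hfisher
  have hN : ∫ _, (1 : ℝ) ∂ν ≠ 0 := by
    intro h
    have : ν = 0 := by simpa [measureReal_def, ENNReal.toReal_eq_zero_iff] using h
    simp [this] at hM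
  refine le_of_tendsto_of_tendsto ((hE'.sub (hM'.mul
    ((hM'.div hN' hN).log (div_ne_zero hM.ne' hN)))).const_mul α) (hI'.const_mul 2) ?_
  obtain ⟨x₀, hx₀⟩ := hne
  filter_upwards [hu.eventually_le_atBot ⟨x₀, hx₀⟩, hv.eventually_ge_atTop ⟨x₀, hx₀⟩,
    hM'.eventually_const_lt hM] with n h1 h2 h3
  have hab : (u n : ℝ) ≤ v n := (Subtype.coe_le_coe.2 h1).trans (Subtype.coe_le_coe.2 h2)
  have hsub : Set.Icc (u n : ℝ) (v n) ⊆ A := hA.ordConnected.out (u n).2 (v n).2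
  have hdens : ν.restrict (Set.Icc (u n : ℝ) (v n)) =
      (volume.restrict (Set.Icc (u n : ℝ) (v n))).withDensity
        fun x => ENNReal.ofReal (exp (-W x)) := by
    rw [hν, restrict_withDensity measurableSet_Icc, Measure.restrict_restrict measurableSet_Icc,
      Set.inter_eq_left.2 hsub]
  have hmeas : AEMeasurable (fun x => ENNReal.ofReal (exp (-W x)))
      (volume.restrict (Set.Icc (u n : ℝ) (v n))) := by
    have hc : ContinuousOn (fun x => exp (-W x)) (Set.Icc (u n : ℝ) (v n)) := fun x hx =>
      (hW x (hsub hx)).continuousAt.neg.rexp.continuousWithinAt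
    exact (hc.aemeasurable measurableSet_Icc).ennreal_ofReal
  have hconvert : ∀ h : ℝ → ℝ, ∫ x in Set.Icc (u n : ℝ) (v n), h x ∂ν =
      ∫ x in (u n : ℝ)..(v n), exp (-W x) * h x := by
    intro h
    rw [hdens, integral_withDensity_eq_integral_toReal_smul₀ hmeas (by simp),
      intervalIntegral.integral_of_le hab, integral_Icc_eq_integral_Ioc]
    simp [ENNReal.toReal_ofReal (exp_pos _).le]
  have hfi : IntegrableOn (fun x => exp (-W x) * sq' x ^ 2) (Set.Icc (u n : ℝ) (v n)) := by
    have := hfisher.integrableOn (s := Set.Icc (u n : ℝ) (v n))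
    rw [IntegrableOn, hdens, integrable_withDensity_iff_integrable_smul₀' hmeas (by simp)] at this
    simpa [IntegrableOn, ENNReal.toReal_ofReal (exp_pos _).le] using this
  simp only [Pi.div_apply, hconvert] at h3 ⊢
  have hsqf : ∀ x, √(f x) ^ 2 = f x := fun x => sq_sqrt (hf0 x)
  have := log_sobolev_Icc hab hα (fun x hx => hW x (hsub hx)) (fun x hx => hW' x (hsub hx))
    (fun x hx => hconv x (hsub hx)) (g := fun y => √(f y)) (fun x hx => hsq x (hsub hx)) hfi
    (by simpa only [hsqf] using h3)
  simpa only [hsqf, mul_one] using this
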